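/- arXiv:2107.07299 — 3 statements merged into one kernel-verified Lean document; each statement's English description precedes it below -/
import Mathlib

section
/- Let G be a finite group, V a complex vector space and π : G → End_ℂ(V) a partial representation of G. Regard ℂ[G]⊗V as a left ℂ[G]-module via multiplication on the first tensor factor. Let S be the ℂ[G]-submodule of ℂ[G]⊗V generated by all elements Σ_{g∈G} g⊗v_g − Σ_{g∈G} 1⊗π(g)(v_g), where (v_g)_{g∈G} ranges over the families of vectors of V satisfying Σ_{g∈G} π(k)π(g)(v_g) = Σ_{g∈G} π(kg)(v_g) for all k ∈ G; and let Z be the ℂ[G]-submodule generated by all elements g⊗v − 1⊗π(g)(v) with g ∈ G and v ∈ V_{g⁻¹}. Then S = Z. -/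
open TensorProduct

section PartialRepresentation

variable {G : Type*} [Group G] {V : Type*} [AddCommGroup V] [Module ℂ V] {π : G → Module.End ℂ V}

theorem partialRep_apply_inv_apply (h1 : π 1 = LinearMap.id)
    (h3 : ∀ g h : G, π (g * h) ∘ₗ π h⁻¹ = π g ∘ₗ π h ∘ₗ π h⁻¹) (h : G) (v : V) :
    π h (π h⁻¹ (π h v)) = π h v := by
  have := LinearMap.congr_fun (h3 h h⁻¹) v
  simpa [h1] using this.symm

theorem partialRep_mul_apply (h1 : π 1 = LinearMap.id)
    (h3 : ∀ g h : G, π (g * h) ∘ₗ π h⁻¹ = π g ∘ₗ π h ∘ₗ π h⁻¹) (g h : G) (v : V) :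
    π (g * h) (π h⁻¹ (π h v)) = π g (π h v) := by
  have := LinearMap.congr_fun (h3 g h) (π h v)
  simp only [LinearMap.comp_apply] at this
  rw [this, partialRep_apply_inv_apply h1 h3]

/-- If a submodule `Z` of `ℂ[G] ⊗ V` contains all `g ⊗ v - 1 ⊗ π(g)(v)` with `v ∈ V_{g⁻¹}`, then
it contains every element `∑ g ⊗ v_g` with `∑ π(kg)(v_g) = 0` for all `k`. -/
theorem sum_single_tmul_mem_of_sum_eq_zero [Fintype G] (h1 : π 1 = LinearMap.id)
    (h3 : ∀ g h : G, π (g * h) ∘ₗ π h⁻¹ = π g ∘ₗ π h ∘ₗ π h⁻¹)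
    (Z : Submodule (MonoidAlgebra ℂ G) (MonoidAlgebra ℂ G ⊗[ℂ] V))
    (hZ : ∀ (g : G) (v : V), MonoidAlgebra.single g (1 : ℂ) ⊗ₜ[ℂ] π g⁻¹ (π g v) -
      (1 : MonoidAlgebra ℂ G) ⊗ₜ[ℂ] π g v ∈ Z)
    (v : G → V) (hv : ∀ k : G, ∑ g : G, π (k * g) (v g) = 0) :
    ∑ g : G, MonoidAlgebra.single g (1 : ℂ) ⊗ₜ[ℂ] v g ∈ Z := by
  classical
  suffices H : ∀ (T : Finset G) (v : G → V), (∀ k : G, ∑ g : G, π (k * g) (v g) = 0) →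
      (∀ g ∉ T, v g = 0) → ∑ g : G, MonoidAlgebra.single g (1 : ℂ) ⊗ₜ[ℂ] v g ∈ Z from
    H Finset.univ v hv (fun g hg => absurd (Finset.mem_univ g) hg)
  intro T
  induction T using Finset.induction_on with
  | empty =>
    intro v _ hT
    simp [fun g => hT g (Finset.notMem_empty g)]
  | insert x T _ ih =>
    intro v hv hT
    have key := ih (fun g => v g - π (x⁻¹ * g)⁻¹ (π (x⁻¹ * g) (v g))) ?_ ?_
    · have hsum : ∑ g : G, (MonoidAlgebra.single x (1 : ℂ) : MonoidAlgebra ℂ G) •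
          (MonoidAlgebra.single (x⁻¹ * g) (1 : ℂ) ⊗ₜ[ℂ] π (x⁻¹ * g)⁻¹ (π (x⁻¹ * g) (v g)) -
            (1 : MonoidAlgebra ℂ G) ⊗ₜ[ℂ] π (x⁻¹ * g) (v g)) ∈ Z :=
        Z.sum_mem fun g _ => Z.smul_mem _ (hZ _ _)
      have hadd := Z.add_mem key hsum
      simp only [smul_sub, TensorProduct.smul_tmul', smul_eq_mul,
        MonoidAlgebra.single_mul_single, mul_one, mul_inv_cancel_left, TensorProduct.tmul_sub,
        Finset.sum_sub_distrib, ← TensorProduct.tmul_sum, hv, TensorProduct.tmul_zero] at hadd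
      simpa using hadd
    · intro k
      have hk : ∀ g : G, π (k * g) (π (x⁻¹ * g)⁻¹ (π (x⁻¹ * g) (v g))) =
          π (k * x) (π (x⁻¹ * g) (v g)) := fun g => by
        rw [← partialRep_mul_apply h1 h3 (k * x) (x⁻¹ * g), mul_assoc k x, mul_inv_cancel_left]
      simp only [map_sub, Finset.sum_sub_distrib, hk, ← map_sum, hv, map_zero, sub_zero]
    · intro g hg
      by_cases hgx : g = x
      · simp [hgx, h1]
      · simp [hT g (by simp [hgx, hg])]

end PartialRepresentation

/-- Proposition 4.16: for a partial representation `π` of a finite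
group `G` on a complex vector space `V`, the `ℂ[G]`-submodule `S` of `ℂ[G] ⊗ V`
generated by the elements `Σ_g g⊗v_g − Σ_g 1⊗π(g)(v_g)` (for families `(v_g)` with
`Σ_g π(k)π(g)(v_g) = Σ_g π(kg)(v_g)` for all `k`) coincides with the
`ℂ[G]`-submodule `Z` generated by the elements `g⊗v − 1⊗π(g)(v)` with `v ∈ V_{g⁻¹}`. -/
theorem statement14 (G : Type*) [Group G] [Fintype G]
    (V : Type*) [AddCommGroup V] [Module ℂ V]
    (π : G → Module.End ℂ V)
    (h1 : π 1 = LinearMap.id)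
    (h2 : ∀ g h : G, π g⁻¹ ∘ₗ π (g * h) = π g⁻¹ ∘ₗ π g ∘ₗ π h)
    (h3 : ∀ g h : G, π (g * h) ∘ₗ π h⁻¹ = π g ∘ₗ π h ∘ₗ π h⁻¹) :
    Submodule.span (MonoidAlgebra ℂ G)
      { s : MonoidAlgebra ℂ G ⊗[ℂ] V | ∃ v : G → V,
          (∀ kk : G, ∑ g : G, π kk (π g (v g)) = ∑ g : G, π (kk * g) (v g)) ∧
          s = (∑ g : G, MonoidAlgebra.single g (1 : ℂ) ⊗ₜ[ℂ] v g) -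
              ∑ g : G, (1 : MonoidAlgebra ℂ G) ⊗ₜ[ℂ] π g (v g) } =
    Submodule.span (MonoidAlgebra ℂ G)
      { z : MonoidAlgebra ℂ G ⊗[ℂ] V | ∃ (g : G) (v : V),
          v ∈ LinearMap.range (π g⁻¹ ∘ₗ π g) ∧
          z = MonoidAlgebra.single g (1 : ℂ) ⊗ₜ[ℂ] v -
              (1 : MonoidAlgebra ℂ G) ⊗ₜ[ℂ] π g v } := by
  classical
  apply le_antisymm
  · rw [Submodule.span_le]
    rintro _ ⟨v, hv, rfl⟩
    have key := sum_single_tmul_mem_of_sum_eq_zero h1 h3 (Submodule.span (MonoidAlgebra ℂ G)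
      { z : MonoidAlgebra ℂ G ⊗[ℂ] V | ∃ (g : G) (v : V),
          v ∈ LinearMap.range (π g⁻¹ ∘ₗ π g) ∧
          z = MonoidAlgebra.single g (1 : ℂ) ⊗ₜ[ℂ] v -
              (1 : MonoidAlgebra ℂ G) ⊗ₜ[ℂ] π g v })
      (fun g w => Submodule.subset_span
        ⟨g, π g⁻¹ (π g w), ⟨w, rfl⟩, by rw [partialRep_apply_inv_apply h1 h3]⟩)
      (fun g => v g - (Pi.single 1 (∑ h : G, π h (v h)) : G → V) g) ?_
    · simp only [TensorProduct.tmul_sub, Finset.sum_sub_distrib] at key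
      rw [Finset.sum_eq_single (f := fun g => MonoidAlgebra.single g (1 : ℂ) ⊗ₜ[ℂ]
        (Pi.single 1 (∑ h : G, π h (v h)) : G → V) g) 1 (fun g _ hg => by simp [hg])
        (by simp), Pi.single_eq_same, TensorProduct.tmul_sum] at key
      exact key
    · intro k
      simp only [map_sub, Finset.sum_sub_distrib]
      rw [Finset.sum_eq_single (f := fun g => π (k * g)
        ((Pi.single 1 (∑ h : G, π h (v h)) : G → V) g)) 1 (fun g _ hg => by simp [hg])
        (by simp), Pi.single_eq_same, mul_one, map_sum, hv, sub_self]
  · rw [Submodule.span_le]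
    rintro _ ⟨g, _, ⟨w, rfl⟩, rfl⟩
    refine Submodule.subset_span ⟨Pi.single g ((π g⁻¹ ∘ₗ π g) w), fun k => ?_, ?_⟩
    · rw [Finset.sum_eq_single g (fun h _ hh => by simp [hh]) (by simp),
        Finset.sum_eq_single g (fun h _ hh => by simp [hh]) (by simp), Pi.single_eq_same,
        LinearMap.comp_apply, partialRep_mul_apply h1 h3, partialRep_apply_inv_apply h1 h3]
    · rw [Finset.sum_eq_single g (fun h _ hh => by simp [hh]) (by simp),
        Finset.sum_eq_single g (fun h _ hh => by simp [hh]) (by simp), Pi.single_eq_same]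
end

section
/- Let B be a bialgebra over a field k and let C = Mod_B be the abelian monoidal category of right B-modules with tensor product over k (diagonal B-action on tensor products), in which (B,Δ,ε) with the regular right B-action is a coalgebra. There is a bijective correspondence between: (1) geometric partial comodules (M, M•B, π_M, ρ_M) over (B,Δ,ε) in Mod_B; and (2) right B-modules M equipped with a geometric partial comodule structure (M, M•B, π_M, ρ_M) over (B,Δ,ε) in Vect_k such that M•B carries a right B-module structure for which ρ_M : M → M•B and π_M : M⊗B → M•B are B-linear (M⊗B carrying the diagonal B-action). -/
open TensorProduct

universe v u

namespace HPC

variable (k : Type u) [CommRing k]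
variable (B : Type u) [Ring B] [Bialgebra k B]

section Defs

variable {N N' : Type u} [AddCommGroup N] [Module k N] [AddCommGroup N'] [Module k N']

variable {k B}

/-- A (unital, associative) right `B`-module structure on `N`, given as an uncurried
action map `N ⊗ B → N`. -/
def IsRightModule (α : N ⊗[k] B →ₗ[k] N) : Prop :=
  (∀ n : N, α (n ⊗ₜ[k] (1 : B)) = n) ∧
    ∀ (n : N) (a b : B), α (α (n ⊗ₜ[k] a) ⊗ₜ[k] b) = α (n ⊗ₜ[k] (a * b))

/-- The operator `n ↦ n·b` of a right action. -/
noncomputable def actOn (α : N ⊗[k] B →ₗ[k] N) (b : B) : N →ₗ[k] N :=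
  α ∘ₗ (TensorProduct.mk k N B).flip b

/-- The diagonal right `B`-action on `N ⊗ B`:
`(n ⊗ h)·b = (n·b₍₁₎) ⊗ (h·b₍₂₎)` (Sweedler notation). -/
noncomputable def diagAct (α : N ⊗[k] B →ₗ[k] N) :
    (N ⊗[k] B) ⊗[k] B →ₗ[k] N ⊗[k] B :=
  TensorProduct.map α (LinearMap.mul' k B) ∘ₗ
    (TensorProduct.tensorTensorTensorComm k N B B B).toLinearMap ∘ₗ
      LinearMap.lTensor (N ⊗[k] B) (Coalgebra.comul (R := k) (A := B))

/-- `B`-linearity of a map with respect to given right actions. -/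
def IsBLinear (α : N ⊗[k] B →ₗ[k] N) (α' : N' ⊗[k] B →ₗ[k] N') (f : N →ₗ[k] N') : Prop :=
  ∀ (n : N) (b : B), f (α (n ⊗ₜ[k] b)) = α' (f n ⊗ₜ[k] b)

end Defs

section PO

variable {A P W : Type u} [AddCommGroup A] [Module k A] [AddCommGroup P] [Module k P]
  [AddCommGroup W] [Module k W]

variable {k}

/-- The pushout, in `k`-modules, of `π : A → P` and `g : A → W`. -/
def PO (π : A →ₗ[k] P) (g : A →ₗ[k] W) : Type u :=
  (P × W) ⧸ LinearMap.range (π.prod (-g))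

instance (π : A →ₗ[k] P) (g : A →ₗ[k] W) : AddCommGroup (PO π g) :=
  inferInstanceAs (AddCommGroup ((P × W) ⧸ LinearMap.range (π.prod (-g))))

instance (π : A →ₗ[k] P) (g : A →ₗ[k] W) : Module k (PO π g) :=
  inferInstanceAs (Module k ((P × W) ⧸ LinearMap.range (π.prod (-g))))

/-- The projection from `P × W` onto the pushout. -/
def poMk (π : A →ₗ[k] P) (g : A →ₗ[k] W) : P × W →ₗ[k] PO π g :=
  (LinearMap.range (π.prod (-g))).mkQ

/-- The first leg of the pushout. -/
def poInl (π : A →ₗ[k] P) (g : A →ₗ[k] W) : P →ₗ[k] PO π g :=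
  poMk π g ∘ₗ LinearMap.inl k P W

/-- The second leg of the pushout. -/
def poInr (π : A →ₗ[k] P) (g : A →ₗ[k] W) : W →ₗ[k] PO π g :=
  poMk π g ∘ₗ LinearMap.inr k P W

end PO

section GPCConds

variable {M P : Type u} [AddCommGroup M] [Module k M] [AddCommGroup P] [Module k P]

variable {k B}

/-- `M ⊗ ε : M ⊗ B → M`. -/
noncomputable def epsMap : M ⊗[k] B →ₗ[k] M :=
  (TensorProduct.rid k M).toLinearMap ∘ₗ
    LinearMap.lTensor M (Coalgebra.counit (R := k) (A := B))

/-- `ρ ⊗ B : M ⊗ B → P ⊗ B`. -/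
noncomputable def G1 (ρ : M →ₗ[k] P) : M ⊗[k] B →ₗ[k] P ⊗[k] B :=
  LinearMap.rTensor B ρ

/-- `(π ⊗ B) ∘ (M ⊗ Δ) : M ⊗ B → P ⊗ B`. -/
noncomputable def G2 (π : M ⊗[k] B →ₗ[k] P) : M ⊗[k] B →ₗ[k] P ⊗[k] B :=
  LinearMap.rTensor B π ∘ₗ (TensorProduct.assoc k M B B).symm.toLinearMap ∘ₗ
    LinearMap.lTensor M (Coalgebra.comul (R := k) (A := B))

/-- (GPC1) in `Vect_k`. -/
noncomputable def VectCounital (π : M ⊗[k] B →ₗ[k] P) (ρ : M →ₗ[k] P) : Prop :=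
  ∃ e : P →ₗ[k] M, e ∘ₗ π = epsMap ∧ e ∘ₗ ρ = LinearMap.id

/-- (GPC1) in `Mod_B`: the mediating morphism is moreover `B`-linear. -/
noncomputable def ModBCounital (αM : M ⊗[k] B →ₗ[k] M) (αP : P ⊗[k] B →ₗ[k] P)
    (π : M ⊗[k] B →ₗ[k] P) (ρ : M →ₗ[k] P) : Prop :=
  ∃ e : P →ₗ[k] M, e ∘ₗ π = epsMap ∧ e ∘ₗ ρ = LinearMap.id ∧ IsBLinear αP αM e

/-- (GPC2) in `Vect_k`. -/
noncomputable def VectCoassoc (π : M ⊗[k] B →ₗ[k] P) (ρ : M →ₗ[k] P) : Prop :=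
  ∃ θ : PO π (G2 π) ≃ₗ[k] PO π (G1 ρ),
    θ.toLinearMap ∘ₗ poInl π (G2 π) ∘ₗ ρ = poInl π (G1 ρ) ∘ₗ ρ ∧
    θ.toLinearMap ∘ₗ poInr π (G2 π) = poInr π (G1 ρ)

/-- The componentwise action of `b ∈ B` on `P × (P ⊗ B)`, using the action on `P` and
the diagonal action on `P ⊗ B`. -/
noncomputable def prodAct (αP : P ⊗[k] B →ₗ[k] P) (b : B) :
    P × (P ⊗[k] B) →ₗ[k] P × (P ⊗[k] B) :=
  (actOn αP b).prodMap (actOn (diagAct αP) b)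

/-- (GPC2) in `Mod_B`: the pushouts carry the induced right `B`-module structures and
the mediating isomorphism is `B`-linear. -/
noncomputable def ModBCoassoc (αP : P ⊗[k] B →ₗ[k] P)
    (π : M ⊗[k] B →ₗ[k] P) (ρ : M →ₗ[k] P) : Prop :=
  ∃ (β₂ : PO π (G2 π) ⊗[k] B →ₗ[k] PO π (G2 π))
    (β₁ : PO π (G1 ρ) ⊗[k] B →ₗ[k] PO π (G1 ρ))
    (θ : PO π (G2 π) ≃ₗ[k] PO π (G1 ρ)),
    IsRightModule β₂ ∧ IsRightModule β₁ ∧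
    (∀ (x : P × (P ⊗[k] B)) (b : B),
      β₂ (poMk π (G2 π) x ⊗ₜ[k] b) = poMk π (G2 π) (prodAct αP b x)) ∧
    (∀ (x : P × (P ⊗[k] B)) (b : B),
      β₁ (poMk π (G1 ρ) x ⊗ₜ[k] b) = poMk π (G1 ρ) (prodAct αP b x)) ∧
    (θ.toLinearMap ∘ₗ poInl π (G2 π) ∘ₗ ρ = poInl π (G1 ρ) ∘ₗ ρ ∧
      θ.toLinearMap ∘ₗ poInr π (G2 π) = poInr π (G1 ρ)) ∧
    IsBLinear β₂ β₁ θ.toLinearMap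

end GPCConds

section DiagonalAction

variable {k B}
variable {N N' : Type u} [AddCommGroup N] [Module k N] [AddCommGroup N'] [Module k N']

/-- The action of `B ⊗ B` on `N ⊗ B` through which `diagAct` factors. -/
noncomputable def tensorAct (α : N ⊗[k] B →ₗ[k] N) :
    (N ⊗[k] B) ⊗[k] (B ⊗[k] B) →ₗ[k] N ⊗[k] B :=
  TensorProduct.map α (LinearMap.mul' k B) ∘ₗ
    (TensorProduct.tensorTensorTensorComm k N B B B).toLinearMap

theorem tensorAct_tmul (α : N ⊗[k] B →ₗ[k] N) (n : N) (h a b : B) :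
    tensorAct α ((n ⊗ₜ[k] h) ⊗ₜ[k] (a ⊗ₜ[k] b)) = α (n ⊗ₜ[k] a) ⊗ₜ[k] (h * b) := by
  simp [tensorAct]

theorem diagAct_tmul (α : N ⊗[k] B →ₗ[k] N) (x : N ⊗[k] B) (b : B) :
    diagAct α (x ⊗ₜ[k] b) = tensorAct α (x ⊗ₜ[k] Coalgebra.comul (R := k) b) := by
  simp [diagAct, tensorAct]

theorem tensorAct_tensorAct {α : N ⊗[k] B →ₗ[k] N} (hα : IsRightModule α)
    (x : N ⊗[k] B) (s t : B ⊗[k] B) :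
    tensorAct α (tensorAct α (x ⊗ₜ[k] s) ⊗ₜ[k] t) = tensorAct α (x ⊗ₜ[k] (s * t)) := by
  induction x using TensorProduct.induction_on with
  | zero => simp
  | add x y hx hy => simp only [TensorProduct.add_tmul, map_add, hx, hy]
  | tmul n h =>
    induction s using TensorProduct.induction_on with
    | zero => simp
    | add x y hx hy =>
      simp only [TensorProduct.add_tmul, TensorProduct.tmul_add, map_add, hx, hy, add_mul]
    | tmul a c =>
      induction t using TensorProduct.induction_on with
      | zero => simp
      | add x y hx hy => simp only [TensorProduct.tmul_add, map_add, hx, hy, mul_add]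
      | tmul b d =>
        simp only [tensorAct_tmul, Algebra.TensorProduct.tmul_mul_tmul, hα.2, mul_assoc]

theorem IsRightModule.diagAct {α : N ⊗[k] B →ₗ[k] N} (hα : IsRightModule α) :
    IsRightModule (diagAct α) := by
  refine ⟨fun x => ?_, fun x a b => ?_⟩
  · rw [diagAct_tmul, Bialgebra.comul_one, Algebra.TensorProduct.one_def]
    induction x using TensorProduct.induction_on with
    | zero => simp
    | add x y hx hy => simp only [TensorProduct.add_tmul, map_add, hx, hy]
    | tmul n h => rw [tensorAct_tmul, hα.1, mul_one]
  · rw [diagAct_tmul, diagAct_tmul, diagAct_tmul, tensorAct_tensorAct hα, Bialgebra.comul_mul]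

theorem isBLinear_epsMap (α : N ⊗[k] B →ₗ[k] N) :
    IsBLinear (diagAct α) α (epsMap (k := k) (B := B) (M := N)) := by
  intro x b
  have key : ∀ t : B ⊗[k] B, epsMap (tensorAct α (x ⊗ₜ[k] t)) =
      α (epsMap x ⊗ₜ[k] epsMap (k := k) (B := B) (M := B) t) := by
    intro t
    induction x using TensorProduct.induction_on with
    | zero => simp
    | add x y hx hy => simp only [TensorProduct.add_tmul, map_add, hx, hy]
    | tmul n h =>
      induction t using TensorProduct.induction_on with
      | zero => simp
      | add x y hx hy => simp only [TensorProduct.tmul_add, map_add, hx, hy]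
      | tmul a c =>
        simp [tensorAct_tmul, epsMap, ← TensorProduct.smul_tmul', TensorProduct.tmul_smul,
          smul_smul, mul_comm]
  have hb : epsMap (k := k) (B := B) (M := B) (Coalgebra.comul (R := k) b) = b := by
    simp [epsMap]
  rw [diagAct_tmul, key, hb]

theorem isBLinear_rTensor {α : N ⊗[k] B →ₗ[k] N} {α' : N' ⊗[k] B →ₗ[k] N'} {f : N →ₗ[k] N'}
    (hf : IsBLinear α α' f) : IsBLinear (diagAct α) (diagAct α') (LinearMap.rTensor B f) := by
  intro x b
  rw [diagAct_tmul, diagAct_tmul]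
  induction x using TensorProduct.induction_on with
  | zero => simp
  | add x y hx hy => simp only [TensorProduct.add_tmul, map_add, hx, hy]
  | tmul n h =>
    induction Coalgebra.comul (R := k) b using TensorProduct.induction_on with
    | zero => simp
    | add x y hx hy => simp only [TensorProduct.tmul_add, map_add, hx, hy]
    | tmul a c => simp only [tensorAct_tmul, LinearMap.rTensor_tmul, hf n a]

/-- The map `a ⊗ u ↦ (π ⊗ B) (m·a ⊗ s u)`. -/
noncomputable def tripleAct (α : N ⊗[k] B →ₗ[k] N) (π : N ⊗[k] B →ₗ[k] N') (m : N)
    (s : B ⊗[k] B) : B ⊗[k] (B ⊗[k] B) →ₗ[k] N' ⊗[k] B :=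
  LinearMap.rTensor B π ∘ₗ (TensorProduct.assoc k N B B).symm.toLinearMap ∘ₗ
    TensorProduct.map (α ∘ₗ TensorProduct.mk k N B m) (LinearMap.mulLeft k s)

theorem G2_tensorAct (α : N ⊗[k] B →ₗ[k] N) (π : N ⊗[k] B →ₗ[k] N') (m : N) (h : B)
    (t : B ⊗[k] B) :
    G2 π (tensorAct α ((m ⊗ₜ[k] h) ⊗ₜ[k] t)) =
      tripleAct α π m (Coalgebra.comul (R := k) h)
        (LinearMap.lTensor B (Coalgebra.comul (R := k) (A := B)) t) := by
  induction t using TensorProduct.induction_on with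
  | zero => simp
  | add x y hx hy => simp only [TensorProduct.tmul_add, map_add, hx, hy]
  | tmul a c => simp [tensorAct_tmul, G2, tripleAct, Bialgebra.comul_mul]

theorem tensorAct_rTensor {α : N ⊗[k] B →ₗ[k] N} {α' : N' ⊗[k] B →ₗ[k] N'}
    {π : N ⊗[k] B →ₗ[k] N'} (hπ : IsBLinear (diagAct α) α' π) (m : N) (s t : B ⊗[k] B) :
    tensorAct α' (LinearMap.rTensor B π
        ((TensorProduct.assoc k N B B).symm (m ⊗ₜ[k] s)) ⊗ₜ[k] t) =
      tripleAct α π m s (TensorProduct.assoc k B B B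
        (LinearMap.rTensor B (Coalgebra.comul (R := k) (A := B)) t)) := by
  induction t using TensorProduct.induction_on with
  | zero => simp
  | add x y hx hy => simp only [TensorProduct.tmul_add, map_add, hx, hy]
  | tmul a c =>
    induction s using TensorProduct.induction_on with
    | zero => simp [tripleAct]
    | add x y hx hy =>
      have hadd : tripleAct α π m (x + y) = tripleAct α π m x + tripleAct α π m y := by
        ext; simp [tripleAct, add_mul, TensorProduct.tmul_add]
      simp only [TensorProduct.tmul_add, TensorProduct.add_tmul, map_add, hx, hy, hadd,
        LinearMap.add_apply]
    | tmul g h =>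
      rw [TensorProduct.assoc_symm_tmul, LinearMap.rTensor_tmul, tensorAct_tmul, ← hπ,
        diagAct_tmul, LinearMap.rTensor_tmul]
      induction Coalgebra.comul (R := k) a using TensorProduct.induction_on with
      | zero => simp
      | add x y hx hy => simp only [TensorProduct.tmul_add, TensorProduct.add_tmul, map_add, hx, hy]
      | tmul v w => simp [tensorAct_tmul, tripleAct]

theorem isBLinear_G2 {α : N ⊗[k] B →ₗ[k] N} {α' : N' ⊗[k] B →ₗ[k] N'}
    {π : N ⊗[k] B →ₗ[k] N'} (hπ : IsBLinear (diagAct α) α' π) :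
    IsBLinear (diagAct α) (diagAct α') (G2 π) := by
  intro x b
  rw [diagAct_tmul, diagAct_tmul]
  induction x using TensorProduct.induction_on with
  | zero => simp
  | add x y hx hy => simp only [TensorProduct.add_tmul, map_add, hx, hy]
  | tmul m h =>
    have hG : G2 π (m ⊗ₜ[k] h) = LinearMap.rTensor B π
        ((TensorProduct.assoc k N B B).symm (m ⊗ₜ[k] Coalgebra.comul (R := k) h)) := by
      simp [G2]
    rw [G2_tensorAct, hG, tensorAct_rTensor hπ, Coalgebra.coassoc_apply]

end DiagonalAction

section PushoutAction

variable {k B}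
variable {A P W : Type u} [AddCommGroup A] [Module k A] [AddCommGroup P] [Module k P]
  [AddCommGroup W] [Module k W]

theorem poInr_apply_eq (π : A →ₗ[k] P) (g : A →ₗ[k] W) (a : A) :
    poInr π g (g a) = poInl π g (π a) := by
  refine ((Submodule.Quotient.eq (LinearMap.range (π.prod (-g)))).2 ⟨-a, ?_⟩)
  simp

theorem poInr_surjective {π : A →ₗ[k] P} (hπ : Function.Surjective π) (g : A →ₗ[k] W) :
    Function.Surjective (poInr π g) := by
  intro y
  obtain ⟨⟨p, w⟩, rfl⟩ := Submodule.mkQ_surjective (LinearMap.range (π.prod (-g))) y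
  obtain ⟨a, rfl⟩ := hπ p
  refine ⟨g a + w, ?_⟩
  rw [map_add, poInr_apply_eq]
  change poMk π g (π a, 0) + poMk π g (0, w) = poMk π g (π a, w)
  rw [← map_add]
  simp

/-- Right actions on the corners of a span of `B`-linear maps descend to its pushout. -/
theorem exists_pushout_action {αA : A ⊗[k] B →ₗ[k] A} {αP : P ⊗[k] B →ₗ[k] P}
    {αW : W ⊗[k] B →ₗ[k] W} (hP : IsRightModule αP) (hW : IsRightModule αW)
    {π : A →ₗ[k] P} {g : A →ₗ[k] W} (hπ : IsBLinear αA αP π) (hg : IsBLinear αA αW g) :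
    ∃ β : PO π g ⊗[k] B →ₗ[k] PO π g, IsRightModule β ∧
      ∀ (x : P × W) (b : B), β (poMk π g x ⊗ₜ[k] b) =
        poMk π g (αP (x.1 ⊗ₜ[k] b), αW (x.2 ⊗ₜ[k] b)) := by
  let γ : P × W →ₗ[k] B →ₗ[k] PO π g :=
    LinearMap.mk₂ k (fun x b => poMk π g (αP (x.1 ⊗ₜ[k] b), αW (x.2 ⊗ₜ[k] b)))
      (fun x y b => by rw [← map_add]; simp [TensorProduct.add_tmul])
      (fun c x b => by rw [← map_smul]; simp [← TensorProduct.smul_tmul'])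
      (fun x b c => by rw [← map_add]; simp [TensorProduct.tmul_add])
      (fun c x b => by rw [← map_smul]; simp)
  have hγ : LinearMap.range (π.prod (-g)) ≤ LinearMap.ker γ := by
    rintro _ ⟨a, rfl⟩
    rw [LinearMap.mem_ker]
    ext b
    refine (Submodule.Quotient.mk_eq_zero (LinearMap.range (π.prod (-g)))).2
      ⟨αA (a ⊗ₜ[k] b), ?_⟩
    simp [hπ a b, hg a b, TensorProduct.neg_tmul]
  let β : PO π g ⊗[k] B →ₗ[k] PO π g :=
    TensorProduct.lift ((LinearMap.range (π.prod (-g))).liftQ γ hγ)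
  have hβ : ∀ (x : P × W) (b : B), β (poMk π g x ⊗ₜ[k] b) =
      poMk π g (αP (x.1 ⊗ₜ[k] b), αW (x.2 ⊗ₜ[k] b)) := fun _ _ => rfl
  refine ⟨β, ⟨fun y => ?_, fun y a b => ?_⟩, hβ⟩ <;>
    obtain ⟨x, rfl⟩ := Submodule.mkQ_surjective (LinearMap.range (π.prod (-g))) y
  · exact (hβ x 1).trans (by rw [hP.1, hW.1]; rfl)
  · change β (β (poMk π g x ⊗ₜ[k] a) ⊗ₜ[k] b) = β (poMk π g x ⊗ₜ[k] (a * b))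
    simp only [hβ, hP.2, hW.2]

end PushoutAction

theorem IsBLinear.of_comp_surjective {k B : Type u} [CommRing k] [Ring B] [Bialgebra k B]
    {X Y Z : Type u} [AddCommGroup X] [Module k X] [AddCommGroup Y] [Module k Y]
    [AddCommGroup Z] [Module k Z]
    {αX : X ⊗[k] B →ₗ[k] X} {αY : Y ⊗[k] B →ₗ[k] Y} {αZ : Z ⊗[k] B →ₗ[k] Z}
    {f : X →ₗ[k] Y} {g : Y →ₗ[k] Z} (hs : Function.Surjective f)
    (hf : IsBLinear αX αY f) (hgf : IsBLinear αX αZ (g ∘ₗ f)) : IsBLinear αY αZ g := by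
  intro y b
  obtain ⟨x, rfl⟩ := hs y
  rw [← hf]
  exact hgf x b

end HPC

open HPC

/-- Lemma 5.1: for a bialgebra `B` over a field `k`, geometric
partial comodule structures over `(B,Δ,ε)` in `Mod_B` on given underlying data
correspond bijectively to right `B`-module structures together with geometric partial
comodule structures over `(B,Δ,ε)` in `Vect_k` for which `M•B` is a `B`-module and
`ρ_M` and `π_M` are `B`-linear: given the common underlying data (a right `B`-module
`M`, a right `B`-module `M•B = P`, a surjective `B`-linear `π : M ⊗ B → P` and a
`B`-linear `ρ : M → P`), the conditions (GPC1)–(GPC2) in `Mod_B` hold if and only if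
the conditions (GPC1)–(GPC2) in `Vect_k` hold. -/
theorem statement17 (k : Type u) [Field k] (B : Type u) [Ring B] [Bialgebra k B]
    (M : Type u) [AddCommGroup M] [Module k M]
    (αM : M ⊗[k] B →ₗ[k] M) (hM : IsRightModule αM)
    (P : Type u) [AddCommGroup P] [Module k P]
    (αP : P ⊗[k] B →ₗ[k] P) (hP : IsRightModule αP)
    (π : M ⊗[k] B →ₗ[k] P) (hπs : Function.Surjective π)
    (hπ : IsBLinear (diagAct αM) αP π)
    (ρ : M →ₗ[k] P) (hρ : IsBLinear αM αP ρ) :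
    (ModBCounital αM αP π ρ ∧ ModBCoassoc αP π ρ) ↔
      (VectCounital π ρ ∧ VectCoassoc π ρ) := by
  constructor
  · rintro ⟨⟨e, h₁, h₂, -⟩, ⟨-, -, θ, -, -, -, -, h, -⟩⟩
    exact ⟨⟨e, h₁, h₂⟩, ⟨θ, h⟩⟩
  · rintro ⟨⟨e, h₁, h₂⟩, ⟨θ, hl, hr⟩⟩
    refine ⟨⟨e, h₁, h₂, hπ.of_comp_surjective hπs (h₁ ▸ isBLinear_epsMap αM)⟩, ?_⟩
    obtain ⟨β₂, hm₂, hβ₂⟩ := exists_pushout_action hP hP.diagAct hπ (isBLinear_G2 hπ)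
    obtain ⟨β₁, hm₁, hβ₁⟩ := exists_pushout_action hP hP.diagAct hπ (isBLinear_rTensor hρ)
    have inr_linear {g : M ⊗[k] B →ₗ[k] P ⊗[k] B} {β : PO π g ⊗[k] B →ₗ[k] PO π g}
        (hβ : ∀ (x : P × (P ⊗[k] B)) (b : B), β (poMk π g x ⊗ₜ[k] b) =
          poMk π g (αP (x.1 ⊗ₜ[k] b), diagAct αP (x.2 ⊗ₜ[k] b))) :
        IsBLinear (diagAct αP) β (poInr π g) := by
      intro w b
      refine Eq.trans ?_ (hβ (0, w) b).symm
      simp [poInr]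
    exact ⟨β₂, β₁, θ, hm₂, hm₁, hβ₂, hβ₁, ⟨hl, hr⟩,
      (inr_linear hβ₂).of_comp_surjective (poInr_surjective hπs _) (hr ▸ inr_linear hβ₁)⟩
end

section
/- Let H be a Hopf algebra over a field k with antipode S, let φ : H → k be a morphism of algebras, and let k_φ denote k with the right H-module structure λ·x = λφ(x). Then, up to isomorphism of geometric partial comodules, the only right Hopf partial comodule structure on k_φ is the trivial partial comodule structure (k, k, k⊗ε, id_k), in which the coaction ρ is the identity of k and the projection π : k⊗H → k is k⊗ε. -/
open TensorProduct

universe v u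

namespace HPC

variable (k : Type u) [Field k]
variable (B : Type u) [Ring B] [HopfAlgebra k B]

/-- The right `B`-action on `k` induced by an algebra morphism `φ : B → k`:
`λ·b = λ·φ(b)`. -/
noncomputable def phiAct (φ : B →ₐ[k] k) : k ⊗[k] B →ₗ[k] k :=
  (TensorProduct.lid k k).toLinearMap ∘ₗ LinearMap.lTensor k φ.toLinearMap

/-- `k ⊗ ε : k ⊗ B → k`, the projection of the trivial partial comodule structure. -/
noncomputable def epsK : k ⊗[k] B →ₗ[k] k :=
  (TensorProduct.lid k k).toLinearMap ∘ₗ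
    LinearMap.lTensor k (Coalgebra.counit (R := k) (A := B))

end HPC

namespace HPC

section Pushout

variable {k : Type u} [CommRing k] {A P W : Type u} [AddCommGroup A] [Module k A]
  [AddCommGroup P] [Module k P] [AddCommGroup W] [Module k W]

theorem poInl_comp (π : A →ₗ[k] P) (g : A →ₗ[k] W) (a : A) :
    poInl π g (π a) = poInr π g (g a) := by
  refine (Submodule.Quotient.eq _).2 ⟨a, ?_⟩
  simp

theorem poInr_eq_poInr {π : A →ₗ[k] P} {g : A →ₗ[k] W} {w w' : W}
    (h : poInr π g w = poInr π g w') : ∃ a, π a = 0 ∧ g a = w' - w := by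
  obtain ⟨a, ha⟩ := (Submodule.Quotient.eq _).1 h
  obtain ⟨h0, h1⟩ := Prod.ext_iff.1 ha
  have h1' : -g a = w - w' := h1
  exact ⟨a, h0.trans (sub_self 0), by rw [← neg_sub w w', ← h1', neg_neg]⟩

end Pushout

section Twist

variable {k : Type u} [Field k] {B : Type u} [Ring B] [HopfAlgebra k B]

/-- The map `b ↦ f(b₍₁₎) b₍₂₎`. -/
noncomputable def twist (f : B →ₗ[k] k) : B →ₗ[k] B :=
  (TensorProduct.lid k B).toLinearMap ∘ₗ LinearMap.rTensor B f ∘ₗ Coalgebra.comul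

theorem twist_eq_sum (f : B →ₗ[k] k) {b : B} {ι : Type*} (s : Coalgebra.Repr k b ι) :
    twist f b = ∑ i ∈ s.index, f (s.left i) • s.right i := by
  simp [twist, ← s.eq]

theorem counit_twist : twist (Coalgebra.counit (R := k) (A := B)) = LinearMap.id := by
  ext b
  simp [twist]

/-- The linear functional `b ↦ f(b₍₁₎) g(b₍₂₎)`. -/
noncomputable def conv (f g : B →ₗ[k] k) : B →ₗ[k] k :=
  g ∘ₗ twist f

theorem twist_twist (f g : B →ₗ[k] k) (b : B) : twist g (twist f b) = twist (conv f g) b := by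
  let L : B ⊗[k] (B ⊗[k] B) →ₗ[k] B := (TensorProduct.lid k B).toLinearMap ∘ₗ
    LinearMap.rTensor B g ∘ₗ (TensorProduct.lid k (B ⊗[k] B)).toLinearMap ∘ₗ
      LinearMap.rTensor (B ⊗[k] B) f
  have hl (t : B ⊗[k] B) : L (LinearMap.lTensor B Coalgebra.comul t) =
      twist g (TensorProduct.lid k B (LinearMap.rTensor B f t)) := by
    induction t with
    | zero => simp
    | add x y hx hy => simp only [map_add, hx, hy]
    | tmul x y => simp [L, twist]
  have hr' (z : B ⊗[k] B) (y : B) : L (TensorProduct.assoc k B B B (z ⊗ₜ[k] y)) =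
      g (TensorProduct.lid k B (LinearMap.rTensor B f z)) • y := by
    induction z with
    | zero => simp
    | add x y hx hy => simp only [TensorProduct.add_tmul, map_add, hx, hy, add_smul]
    | tmul x z => simp [L, TensorProduct.smul_tmul']
  have hr (t : B ⊗[k] B) :
      L (TensorProduct.assoc k B B B (LinearMap.rTensor B Coalgebra.comul t)) =
        TensorProduct.lid k B (LinearMap.rTensor B (conv f g) t) := by
    induction t with
    | zero => simp
    | add x y hx hy => simp only [map_add, hx, hy]
    | tmul x y => simp [hr', conv, twist]
  exact (hl _).symm.trans ((congrArg L (Coalgebra.coassoc_apply (R := k) b)).symm.trans (hr _))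

theorem conv_antipode (φ : B →ₐ[k] k) :
    conv (φ.toLinearMap ∘ₗ HopfAlgebra.antipode k) φ.toLinearMap = Coalgebra.counit := by
  ext b
  let s := Coalgebra.Repr.arbitrary k b
  have h := congrArg φ (HopfAlgebra.sum_antipode_mul_eq_algebraMap_counit s)
  simpa [conv, twist_eq_sum _ s] using h

theorem diagAct_phiAct (φ : B →ₐ[k] k) (h b : B) :
    diagAct (phiAct k B φ) ((1 ⊗ₜ[k] h) ⊗ₜ[k] b) = 1 ⊗ₜ[k] (h * twist φ.toLinearMap b) := by
  let s := Coalgebra.Repr.arbitrary k b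
  rw [twist_eq_sum _ s]
  simp [diagAct, phiAct, ← s.eq, TensorProduct.tmul_sum, Finset.mul_sum, TensorProduct.smul_tmul']

theorem coaction_one_eq {P : Type u} [AddCommGroup P] [Module k P]
    {π : k ⊗[k] B →ₗ[k] P} {ρ : k →ₗ[k] P} {e : P →ₗ[k] k}
    (heπ : e ∘ₗ π = epsMap) (heρ : e ∘ₗ ρ = LinearMap.id) (hca : VectCoassoc π ρ) {g : B}
    (hg : π (1 ⊗ₜ[k] g) = ρ 1) :
    G2 π (1 ⊗ₜ[k] g) = ρ 1 ⊗ₜ[k] g := by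
  obtain ⟨θ, h1, h2⟩ := hca
  have h1' := LinearMap.congr_fun h1 1
  have h2' := LinearMap.congr_fun h2 (G2 π (1 ⊗ₜ[k] g))
  simp only [LinearMap.comp_apply, LinearEquiv.coe_coe] at h1' h2'
  rw [← hg, poInl_comp, poInl_comp, h2'] at h1'
  obtain ⟨a, -, ha⟩ := poInr_eq_poInr h1'
  obtain ⟨c, rfl⟩ : ∃ c, a = 1 ⊗ₜ[k] c :=
    ⟨TensorProduct.lid k B a, by rw [← TensorProduct.lid_symm_apply, LinearEquiv.symm_apply_apply]⟩
  have hρ : e (ρ 1) = 1 := LinearMap.congr_fun heρ 1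
  have hG (x : B) : TensorProduct.lid k B (LinearMap.rTensor B e (G1 ρ (1 ⊗ₜ[k] x))) = x := by
    simp [G1, hρ]
  have hG2 : TensorProduct.lid k B (LinearMap.rTensor B e (G2 π (1 ⊗ₜ[k] g))) = g := by
    let s := Coalgebra.Repr.arbitrary k g
    have heπ' (x : B) : e (π (1 ⊗ₜ[k] x)) = Coalgebra.counit x := by
      simpa [epsMap] using LinearMap.congr_fun heπ (1 ⊗ₜ[k] x)
    simp only [G2, ← s.eq, LinearMap.comp_apply, LinearMap.lTensor_tmul, TensorProduct.tmul_sum,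
      map_sum, LinearEquiv.coe_coe, TensorProduct.assoc_symm_tmul, LinearMap.rTensor_tmul, heπ',
      TensorProduct.lid_tmul]
    exact Coalgebra.sum_counit_smul s
  have hc := congrArg (fun x => TensorProduct.lid k B (LinearMap.rTensor B e x)) ha
  simp only [map_sub, hG, hG2, sub_self] at hc
  rw [hc, TensorProduct.tmul_zero, map_zero] at ha
  simpa [G1] using (sub_eq_zero.1 ha.symm).symm

theorem projection_eq {φ : B →ₐ[k] k} {P : Type u} [AddCommGroup P] [Module k P]
    {αP : P ⊗[k] B →ₗ[k] P} {π : k ⊗[k] B →ₗ[k] P} (hπs : Function.Surjective π)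
    (hπ : IsBLinear (diagAct (phiAct k B φ)) αP π)
    {ρ : k →ₗ[k] P} (hρ : IsBLinear (phiAct k B φ) αP ρ) {e : P →ₗ[k] k}
    (heπ : e ∘ₗ π = epsMap) (heρ : e ∘ₗ ρ = LinearMap.id) (hca : VectCoassoc π ρ) (b : B) :
    π (1 ⊗ₜ[k] b) = Coalgebra.counit (R := k) b • ρ 1 := by
  set σ := twist (φ.toLinearMap ∘ₗ HopfAlgebra.antipode k) with hσ
  have hφσ (b : B) : φ (σ b) = Coalgebra.counit b :=
    LinearMap.congr_fun (conv_antipode φ) b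
  have hπσ (h b : B) : αP (π (1 ⊗ₜ[k] h) ⊗ₜ[k] σ b) = π (1 ⊗ₜ[k] (h * b)) := by
    rw [← hπ, diagAct_phiAct, hσ, twist_twist, conv_antipode, counit_twist, LinearMap.id_apply]
  have hρσ (b : B) : αP (ρ 1 ⊗ₜ[k] σ b) = Coalgebra.counit (R := k) b • ρ 1 := by
    rw [← hρ, ← map_smul]
    simp [phiAct, hφσ]
  obtain ⟨a, ha⟩ := hπs (ρ 1)
  obtain ⟨g, rfl⟩ : ∃ g, a = 1 ⊗ₜ[k] g :=
    ⟨TensorProduct.lid k B a, by rw [← TensorProduct.lid_symm_apply, LinearEquiv.symm_apply_apply]⟩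
  have hεg : Coalgebra.counit (R := k) g = 1 := by
    have h := LinearMap.congr_fun heπ (1 ⊗ₜ[k] g)
    rw [LinearMap.comp_apply, ha, show e (ρ 1) = 1 from LinearMap.congr_fun heρ 1] at h
    simpa [epsMap] using h.symm
  have hone : π (1 ⊗ₜ[k] (1 : B)) = ρ 1 := by
    have h := congrArg (αP ∘ₗ LinearMap.lTensor P (σ ∘ₗ HopfAlgebra.antipode k))
      (coaction_one_eq heπ heρ hca ha)
    let s := Coalgebra.Repr.arbitrary k g
    simp only [G2, ← s.eq, LinearMap.comp_apply, LinearMap.lTensor_tmul, TensorProduct.tmul_sum,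
      map_sum, LinearEquiv.coe_coe, TensorProduct.assoc_symm_tmul, LinearMap.rTensor_tmul,
      hπσ, hρσ] at h
    rw [← map_sum, ← TensorProduct.tmul_sum, HopfAlgebra.sum_mul_antipode_eq_algebraMap_counit s,
      HopfAlgebra.counit_antipode, hεg, map_one, one_smul] at h
    exact h
  have h := hπσ 1 b
  rwa [hone, hρσ, one_mul, eq_comm] at h

end Twist

end HPC

open HPC in
/-- Corollary 5.8: for a Hopf algebra `H` over a field `k` and an
algebra morphism `φ : H → k`, every right Hopf partial comodule structure on `k_φ`
(the field `k` with right `H`-action through `φ`) is isomorphic, as a geometric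
partial comodule in `Mod_H`, to the trivial partial comodule structure
`(k, k, k ⊗ ε, id)`. -/
theorem statement19 (k : Type u) [Field k] (B : Type u) [Ring B] [HopfAlgebra k B]
    (φ : B →ₐ[k] k)
    (P : Type u) [AddCommGroup P] [Module k P]
    (αP : P ⊗[k] B →ₗ[k] P) (hP : IsRightModule αP)
    (π : k ⊗[k] B →ₗ[k] P) (hπs : Function.Surjective π)
    (hπ : IsBLinear (diagAct (phiAct k B φ)) αP π)
    (ρ : k →ₗ[k] P) (hρ : IsBLinear (phiAct k B φ) αP ρ)
    (hcu : ModBCounital (phiAct k B φ) αP π ρ)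
    (hca : ModBCoassoc αP π ρ) :
    ∃ (f : k →ₗ[k] k) (fH : P →ₗ[k] k),
      Function.Bijective f ∧ Function.Bijective fH ∧
      IsBLinear (phiAct k B φ) (phiAct k B φ) f ∧
      IsBLinear αP (phiAct k B φ) fH ∧
      fH ∘ₗ ρ = f ∧
      fH ∘ₗ π = epsK k B ∘ₗ LinearMap.rTensor B f := by
  obtain ⟨e, heπ, heρ, he⟩ := hcu
  obtain ⟨-, -, θ, -, -, -, -, hθ, -⟩ := hca
  have hP := projection_eq hπs hπ hρ heπ heρ ⟨θ, hθ⟩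
  have heρ1 : e (ρ 1) = 1 := LinearMap.congr_fun heρ 1
  refine ⟨LinearMap.id, e, Function.bijective_id, ⟨?_, fun c => ⟨ρ c, LinearMap.congr_fun heρ c⟩⟩,
    fun _ _ => rfl, he, heρ, ?_⟩
  · rw [injective_iff_map_eq_zero]
    intro x hx
    obtain ⟨a, rfl⟩ := hπs x
    obtain ⟨b, rfl⟩ : ∃ b, a = 1 ⊗ₜ[k] b :=
      ⟨TensorProduct.lid k B a,
        by rw [← TensorProduct.lid_symm_apply, LinearEquiv.symm_apply_apply]⟩
    rw [hP, map_smul, heρ1, smul_eq_mul, mul_one] at hx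
    rw [hP, hx, zero_smul]
  · rw [heπ]
    ext b
    simp [epsMap, epsK]
end
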